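/- Let s ≥ 1, f ∈ C^s[0,1] with f(0), f(1), f'(0), f'(1) ∈ ℤ and f^(i)(0) = f^(i)(1) = 0 for i = 2,…,s. Define b̂_n(k) = ⟨f(k/n) C(n,k)⟩ / C(n,k) with ⟨·⟩ a nearest integer. Then there is a constant c = c(s) such that for all n ≥ s, max_{0 ≤ k ≤ n} |f(k/n) − b̂_n(k)| ≤ (c/n^s)(ω₁(f^(s), 1/n) + 1/n). -/

import Mathlib

/-- The modulus of continuity of `F` on `[0,1]`. -/
noncomputable def omega1 (F : ℝ → ℝ) (t : ℝ) : ℝ :=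
  sSup {d : ℝ | ∃ x ∈ Set.Icc (0:ℝ) 1, ∃ y ∈ Set.Icc (0:ℝ) 1, |x - y| ≤ t ∧ d = |F x - F y|}

open Set

theorem Nat.choose_le_choose_of_le_half {n r k : ℕ} (hrk : r ≤ k) (hk : k ≤ n / 2) :
    n.choose r ≤ n.choose k := by
  induction k, hrk using Nat.le_induction with
  | base => exact le_rfl
  | succ k _ ih => exact (ih (by omega)).trans (Nat.choose_le_succ_of_lt_half_left (by omega))

theorem Nat.choose_le_choose_of_le_of_add_le {n r k : ℕ} (hrk : r ≤ k) (hk : k + r ≤ n) :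
    n.choose r ≤ n.choose k := by
  by_cases h : k ≤ n / 2
  · exact Nat.choose_le_choose_of_le_half hrk h
  · rw [← Nat.choose_symm (show k ≤ n by omega)]
    exact Nat.choose_le_choose_of_le_half (by omega) (by omega)

theorem Nat.pow_le_pow_mul_choose {n r : ℕ} (h : r ≤ n) : n ^ r ≤ r ^ r * n.choose r := by
  induction r generalizing n with
  | zero => simp
  | succ r ih =>
    obtain ⟨m, rfl⟩ : ∃ m, n = m + 1 := ⟨n - 1, by omega⟩
    have hrm : r ≤ m := by omega
    have key : (m + 1) ^ r ≤ (r + 1) ^ r * m.choose r := by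
      rcases Nat.eq_zero_or_pos r with rfl | hr
      · simp
      · refine Nat.le_of_mul_le_mul_left ?_ (pow_pos hr r)
        calc r ^ r * (m + 1) ^ r = (r * (m + 1)) ^ r := (mul_pow ..).symm
          _ ≤ ((r + 1) * m) ^ r := Nat.pow_le_pow_left (by nlinarith) r
          _ = (r + 1) ^ r * m ^ r := mul_pow ..
          _ ≤ (r + 1) ^ r * (r ^ r * m.choose r) := Nat.mul_le_mul_left _ (ih hrm)
          _ = r ^ r * ((r + 1) ^ r * m.choose r) := by ring
    calc (m + 1) ^ (r + 1) = (m + 1) ^ r * (m + 1) := pow_succ ..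
      _ ≤ (r + 1) ^ r * m.choose r * (m + 1) := Nat.mul_le_mul_right _ key
      _ = (r + 1) ^ r * ((m + 1) * m.choose r) := by ring
      _ = (r + 1) ^ (r + 1) * (m + 1).choose (r + 1) := by
        rw [Nat.add_one_mul_choose_eq]; ring

theorem omega1_nonneg (F : ℝ → ℝ) (t : ℝ) : 0 ≤ omega1 F t :=
  Real.sSup_nonneg <| by
    rintro d ⟨x, -, y, -, -, rfl⟩
    exact abs_nonneg _

theorem abs_sub_le_omega1 {F : ℝ → ℝ} (hF : ContinuousOn F (Icc 0 1)) {t x y : ℝ}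
    (hx : x ∈ Icc (0 : ℝ) 1) (hy : y ∈ Icc (0 : ℝ) 1) (hxy : |x - y| ≤ t) :
    |F x - F y| ≤ omega1 F t := by
  refine le_csSup ?_ ⟨x, hx, y, hy, hxy, rfl⟩
  obtain ⟨C, hC⟩ := isCompact_Icc.exists_bound_of_continuousOn hF
  refine ⟨C + C, ?_⟩
  rintro d ⟨x, hx, y, hy, -, rfl⟩
  exact (abs_sub _ _).trans (add_le_add (hC x hx) (hC y hy))

theorem abs_sub_le_nat_mul_omega1 {F : ℝ → ℝ} (hF : ContinuousOn F (Icc 0 1)) {t : ℝ} (k : ℕ)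
    {x y : ℝ} (hx : x ∈ Icc (0 : ℝ) 1) (hy : y ∈ Icc (0 : ℝ) 1) (hxy : |x - y| ≤ k * t) :
    |F x - F y| ≤ k * omega1 F t := by
  induction k generalizing x y with
  | zero =>
    have : x = y := by
      rw [← sub_eq_zero, ← abs_nonpos_iff]
      simpa using hxy
    simp [this]
  | succ k ih =>
    have hk : (0 : ℝ) < k + 1 := by positivity
    push_cast at hxy ⊢
    have hd : |x - y| / (k + 1) ≤ t := by rwa [div_le_iff₀' hk]
    set z := x + (1 / (k + 1) : ℝ) • (y - x) with hz
    have hzI : z ∈ Icc (0 : ℝ) 1 :=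
      (convex_Icc (0 : ℝ) 1).add_smul_sub_mem hx hy
        ⟨by positivity, by rw [div_le_one hk]; linarith [(Nat.cast_nonneg k : (0 : ℝ) ≤ k)]⟩
    have hxz : |x - z| ≤ t := by
      have : x - z = (x - y) / (k + 1) := by rw [hz, smul_eq_mul]; field_simp; ring
      rwa [this, abs_div, abs_of_pos hk]
    have hzy : |z - y| ≤ k * t := by
      have : z - y = k * ((x - y) / (k + 1)) := by rw [hz, smul_eq_mul]; field_simp; ring
      rw [this, abs_mul, abs_div, abs_of_pos hk, Nat.abs_cast]
      gcongr
    calc |F x - F y| ≤ |F x - F z| + |F z - F y| := abs_sub_le _ _ _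
      _ ≤ omega1 F t + k * omega1 F t :=
        add_le_add (abs_sub_le_omega1 hF hx hzI hxz) (ih hzI hy hzy)
      _ = (k + 1) * omega1 F t := by ring

theorem abs_sub_le_mul_of_hasDerivWithinAt_Icc {g g' : ℝ → ℝ} {a r C : ℝ}
    (ha : a ∈ Icc (0 : ℝ) 1) (hg : ∀ t ∈ Icc (0 : ℝ) 1, HasDerivWithinAt g (g' t) (Icc 0 1) t)
    (hC : ∀ t ∈ Icc (0 : ℝ) 1, |t - a| ≤ r → |g' t| ≤ C) (hC0 : 0 ≤ C)
    {t : ℝ} (ht : t ∈ Icc (0 : ℝ) 1) (htr : |t - a| ≤ r) : |g t - g a| ≤ C * r := by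
  have hconv : Convex ℝ (Icc (0 : ℝ) 1 ∩ Metric.closedBall a r) :=
    (convex_Icc 0 1).inter (convex_closedBall a r)
  have h := hconv.norm_image_sub_le_of_norm_hasDerivWithin_le (f := g) (f' := g') (C := C)
    (x := a) (y := t)
    (fun u hu => (hg u hu.1).mono inter_subset_left)
    (fun u hu => hC u hu.1 (by simpa [Real.dist_eq] using hu.2))
    ⟨ha, Metric.mem_closedBall_self ((abs_nonneg _).trans htr)⟩
    ⟨ht, by simpa [Real.dist_eq] using htr⟩
  exact h.trans (mul_le_mul_of_nonneg_left htr hC0)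

/-- Taylor estimate around a point where all derivatives of order `2, …, s` vanish, in terms of a
bound for the oscillation of the top derivative. -/
theorem abs_sub_affine_le {s : ℕ} (hs : 1 ≤ s) {f : ℝ → ℝ} (hf : ContDiffOn ℝ s f (Icc 0 1))
    {a r M : ℝ} (ha : a ∈ Icc (0 : ℝ) 1) (hr : 0 ≤ r) (hM : 0 ≤ M)
    (hzero : ∀ i, 2 ≤ i → i ≤ s → iteratedDerivWithin i f (Icc 0 1) a = 0)
    (hosc : ∀ t ∈ Icc (0 : ℝ) 1, |t - a| ≤ r →
      |iteratedDerivWithin s f (Icc 0 1) t - iteratedDerivWithin s f (Icc 0 1) a| ≤ M)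
    {t : ℝ} (ht : t ∈ Icc (0 : ℝ) 1) (htr : |t - a| ≤ r) :
    |f t - (f a + derivWithin f (Icc 0 1) a * (t - a))| ≤ M * r ^ s := by
  have hU : UniqueDiffOn ℝ (Icc (0 : ℝ) 1) := uniqueDiffOn_Icc one_pos
  have hderiv : ∀ j, j < s → ∀ u ∈ Icc (0 : ℝ) 1,
      HasDerivWithinAt (iteratedDerivWithin j f (Icc 0 1))
        (iteratedDerivWithin (j + 1) f (Icc 0 1) u) (Icc 0 1) u := fun j hj u hu => by
    rw [iteratedDerivWithin_succ]
    exact (hf.differentiableOn_iteratedDerivWithin (by exact_mod_cast hj) hU u hu).hasDerivWithinAt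
  have main : ∀ d, d + 1 ≤ s → ∀ u ∈ Icc (0 : ℝ) 1, |u - a| ≤ r →
      |iteratedDerivWithin (s - d) f (Icc 0 1) u - iteratedDerivWithin (s - d) f (Icc 0 1) a|
        ≤ M * r ^ d := by
    intro d
    induction d with
    | zero => simpa using fun _ => hosc
    | succ d ih =>
      intro hd u hu hur
      obtain ⟨j, hj⟩ : ∃ j, s - d = j + 1 := ⟨s - d - 1, by omega⟩
      have hj' : s - (d + 1) = j := by omega
      rw [hj', pow_succ, ← mul_assoc]
      refine abs_sub_le_mul_of_hasDerivWithinAt_Icc ha (hderiv j (by omega))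
        (fun v hv hvr => ?_) (by positivity) hu hur
      have := ih (by omega) v hv hvr
      rwa [hj, hzero (j + 1) (by omega) (by omega), sub_zero] at this
  obtain ⟨m, rfl⟩ : ∃ m, s = m + 1 := ⟨s - 1, by omega⟩
  have hone := main m le_rfl
  rw [Nat.add_sub_cancel_left, iteratedDerivWithin_one] at hone
  have hd0 := hderiv 0 (by omega)
  rw [zero_add, iteratedDerivWithin_zero, iteratedDerivWithin_one] at hd0
  have h := abs_sub_le_mul_of_hasDerivWithinAt_Icc
    (g := fun u => f u - derivWithin f (Icc 0 1) a * u)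
    (g' := fun u => derivWithin f (Icc 0 1) u - derivWithin f (Icc 0 1) a) ha
    (fun u hu => by
      simpa using (hd0 u hu).fun_sub ((hasDerivWithinAt_id u _).const_mul (derivWithin f (Icc 0 1) a)))
    hone (by positivity) ht htr
  rw [pow_succ, ← mul_assoc]
  convert h using 2
  ring

theorem abs_sub_nearest_le {nint : ℝ → ℤ} (hnint : ∀ a : ℝ, |a - (nint a : ℝ)| ≤ 1 / 2) (a : ℝ)
    (N : ℤ) : |a - nint a| ≤ |a - N| := by
  by_cases h : nint a = N
  · rw [h]
  · have h1 : (1 : ℝ) ≤ |(nint a : ℝ) - N| := by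
      exact_mod_cast Int.one_le_abs (sub_ne_zero.mpr h)
    have h2 := abs_sub_le (nint a : ℝ) a N
    rw [abs_sub_comm (nint a : ℝ) a] at h2
    linarith [hnint a]

theorem abs_sub_nearest_div_le {nint : ℝ → ℤ} (hnint : ∀ a : ℝ, |a - (nint a : ℝ)| ≤ 1 / 2)
    {y C p : ℝ} (hC : 0 < C) (hp : ∃ N : ℤ, p * C = N) : |y - nint (y * C) / C| ≤ |y - p| := by
  obtain ⟨N, hN⟩ := hp
  have h := abs_sub_nearest_le hnint (y * C) N
  rw [← hN, ← sub_mul, abs_mul, abs_of_pos hC] at h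
  have e : y - nint (y * C) / C = (y * C - nint (y * C)) / C := by field_simp
  rwa [e, abs_div, abs_of_pos hC, div_le_iff₀ hC]

theorem exists_nat_div_mul_choose {n k : ℕ} (hn : 0 < n) :
    ∃ m : ℕ, (k : ℝ) / n * n.choose k = m := by
  obtain ⟨n, rfl⟩ : ∃ m, n = m + 1 := ⟨n - 1, by omega⟩
  rcases k with _ | k
  · exact ⟨0, by simp⟩
  · refine ⟨n.choose k, ?_⟩
    have h : ((n + 1 : ℕ) : ℝ) * n.choose k = (n + 1).choose (k + 1) * ((k + 1 : ℕ) : ℝ) := by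
      exact_mod_cast Nat.add_one_mul_choose_eq n k
    rw [div_mul_eq_mul_div, div_eq_iff (by positivity), mul_comm, ← h, mul_comm]

/-- The estimate near an endpoint `a`, at distance `j / n` with `j ≤ s`. -/
theorem abs_sub_nearest_div_choose_le_near {s : ℕ} (hs : 1 ≤ s) {nint : ℝ → ℤ}
    (hnint : ∀ a : ℝ, |a - (nint a : ℝ)| ≤ 1 / 2) {f : ℝ → ℝ}
    (hf : ContDiffOn ℝ s f (Icc 0 1)) {a : ℝ} (ha : a ∈ Icc (0 : ℝ) 1)
    (hfa : ∃ m : ℤ, f a = m) (hda : ∃ m : ℤ, derivWithin f (Icc 0 1) a = m)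
    (hzero : ∀ i, 2 ≤ i → i ≤ s → iteratedDerivWithin i f (Icc 0 1) a = 0)
    {n k j : ℕ} (hn : 0 < n) (hkn : k ≤ n) (hj : j ≤ s) (hdist : |(k : ℝ) / n - a| = j / n)
    (hint : ∃ m : ℤ, ((k : ℝ) / n - a) * n.choose k = m) :
    |f ((k : ℝ) / n) - nint (f ((k : ℝ) / n) * n.choose k) / n.choose k| ≤
      (s : ℝ) ^ (s + 1) / (n : ℝ) ^ s *
        omega1 (iteratedDerivWithin s f (Icc 0 1)) (1 / n) := by
  have hn' : (0 : ℝ) < n := by exact_mod_cast hn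
  have hC : (0 : ℝ) < n.choose k := by exact_mod_cast Nat.choose_pos hkn
  have hk1 : (k : ℝ) / n ∈ Icc (0 : ℝ) 1 :=
    ⟨by positivity, by rw [div_le_one hn']; exact_mod_cast hkn⟩
  have hcont := hf.continuousOn_iteratedDerivWithin le_rfl (uniqueDiffOn_Icc one_pos)
  have hω := omega1_nonneg (iteratedDerivWithin s f (Icc 0 1)) (1 / n)
  obtain ⟨m₀, hm₀⟩ := hfa
  obtain ⟨m₁, hm₁⟩ := hda
  obtain ⟨m₂, hm₂⟩ := hint
  refine (abs_sub_nearest_div_le hnint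
    (p := f a + derivWithin f (Icc 0 1) a * ((k : ℝ) / n - a)) hC
    ⟨m₀ * n.choose k + m₁ * m₂, ?_⟩).trans ?_
  · push_cast
    rw [add_mul, mul_assoc, hm₀, hm₁, hm₂]
  · have h := abs_sub_affine_le hs hf ha (r := s / n) (by positivity)
      (M := s * omega1 (iteratedDerivWithin s f (Icc 0 1)) (1 / n)) (by positivity) hzero
      (fun t ht htr => abs_sub_le_nat_mul_omega1 hcont s ht ha (by rwa [mul_one_div])) hk1
      (by rw [hdist]; gcongr)
    refine h.trans_eq ?_
    rw [div_pow, pow_succ]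
    ring


theorem nearest_int_coeff_estimate (s : ℕ) (hs : 1 ≤ s) :
    ∃ c : ℝ, 0 < c ∧
      ∀ nint : ℝ → ℤ, (∀ a : ℝ, |a - (nint a : ℝ)| ≤ 1 / 2) →
      ∀ f : ℝ → ℝ,
      ContDiffOn ℝ s f (Set.Icc (0:ℝ) 1) →
      (∃ m : ℤ, f 0 = m) → (∃ m : ℤ, f 1 = m) →
      (∃ m : ℤ, derivWithin f (Set.Icc (0:ℝ) 1) 0 = m) →
      (∃ m : ℤ, derivWithin f (Set.Icc (0:ℝ) 1) 1 = m) →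
      (∀ i : ℕ, 2 ≤ i → i ≤ s → iteratedDerivWithin i f (Set.Icc (0:ℝ) 1) 0 = 0) →
      (∀ i : ℕ, 2 ≤ i → i ≤ s → iteratedDerivWithin i f (Set.Icc (0:ℝ) 1) 1 = 0) →
      ∀ n : ℕ, s ≤ n → ∀ k : ℕ, k ≤ n →
        |f ((k : ℝ) / n) - (nint (f ((k : ℝ) / n) * (n.choose k : ℝ)) : ℝ) / (n.choose k : ℝ)|
          ≤ (c / (n : ℝ) ^ s) *
              (omega1 (iteratedDerivWithin s f (Set.Icc (0:ℝ) 1)) (1 / n) + 1 / n) := by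
  refine ⟨(s + 1 : ℝ) ^ (s + 1), by positivity, ?_⟩
  intro nint hnint f hf hf0 hf1 hd0 hd1 hz0 hz1 n hsn k hkn
  have hn : 0 < n := by omega
  have hn' : (0 : ℝ) < n := by exact_mod_cast hn
  have hω := omega1_nonneg (iteratedDerivWithin s f (Icc 0 1)) (1 / n)
  have near : (s : ℝ) ^ (s + 1) / (n : ℝ) ^ s *
        omega1 (iteratedDerivWithin s f (Icc 0 1)) (1 / n) ≤
      (s + 1 : ℝ) ^ (s + 1) / (n : ℝ) ^ s *
        (omega1 (iteratedDerivWithin s f (Icc 0 1)) (1 / n) + 1 / n) := by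
    gcongr
    · linarith
    · linarith [one_div_pos.mpr hn']
  by_cases hk : k ≤ s
  · obtain ⟨m, hm⟩ := exists_nat_div_mul_choose (k := k) hn
    refine (abs_sub_nearest_div_choose_le_near hs hnint hf (by simp) hf0 hd0 hz0 hn hkn hk
      ?_ ⟨m, ?_⟩).trans near
    · rw [sub_zero, abs_of_nonneg (by positivity)]
    · rw [sub_zero, hm, Int.cast_natCast]
  by_cases hk' : n - k ≤ s
  · obtain ⟨m, hm⟩ := exists_nat_div_mul_choose (k := n - k) hn
    have e : (k : ℝ) / n - 1 = -(((n - k : ℕ) : ℝ) / n) := by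
      rw [Nat.cast_sub hkn]
      field_simp
      ring
    refine (abs_sub_nearest_div_choose_le_near hs hnint hf (by simp) hf1 hd1 hz1 hn hkn hk'
      ?_ ⟨-m, ?_⟩).trans near
    · rw [e, abs_neg, abs_of_nonneg (by positivity)]
    · rw [e, ← Nat.choose_symm hkn, neg_mul, hm, Int.cast_neg, Int.cast_natCast]
  · have hC : (0 : ℝ) < n.choose k := by exact_mod_cast Nat.choose_pos hkn
    have hle : (n : ℝ) ^ (s + 1) ≤ (s + 1 : ℝ) ^ (s + 1) * n.choose k := by
      exact_mod_cast (Nat.pow_le_pow_mul_choose (n := n) (r := s + 1) (by omega)).trans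
        (Nat.mul_le_mul_left _ (Nat.choose_le_choose_of_le_of_add_le (by omega) (by omega)))
    set y := f ((k : ℝ) / n)
    have e : y - nint (y * n.choose k) / n.choose k =
        (y * n.choose k - nint (y * n.choose k)) / n.choose k := by field_simp
    calc |y - nint (y * n.choose k) / n.choose k|
        = |y * n.choose k - nint (y * n.choose k)| / n.choose k := by
          rw [e, abs_div, abs_of_pos hC]
      _ ≤ 1 / n.choose k := by
          gcongr
          linarith [hnint (y * n.choose k)]
      _ ≤ (s + 1 : ℝ) ^ (s + 1) / (n : ℝ) ^ (s + 1) := by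
          rwa [div_le_div_iff₀ hC (by positivity), one_mul]
      _ = (s + 1 : ℝ) ^ (s + 1) / (n : ℝ) ^ s * (1 / n) := by
          rw [pow_succ (n : ℝ), div_mul_div_comm, mul_one]
      _ ≤ _ := by
          gcongr
          linarith
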